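/- Let 𝔟 be a nonzero fractional ideal, 𝔞 := 𝔟𝔠, and L := 𝔟 ⊕ 𝔞* ⊆ F², viewed as row vectors; call a class of (x, y) ∈ 𝔫⁻¹𝔟 × 𝔫⁻¹𝔞* in 𝔫⁻¹L/L primitive if x𝔫𝔟⁻¹ + y𝔫𝔞𝔡 + 𝔫 = 𝔬. Let H be the group of upper triangular matrices (uε ξ; 0 u⁻¹) with u ∈ 𝔬^×, ε ∈ E, ξ ∈ (𝔠𝔟²)*, acting on 𝔫⁻¹L/L by right multiplication of row vectors. For a fractional ideal 𝔟' with 𝔟 ⊆ 𝔟' ⊆ 𝔫⁻¹𝔟 let 𝔬_𝒞^×(𝔟') := { (u, ε) ∈ 𝔬^× × E : u − 1 ∈ 𝔫𝔟'𝔟⁻¹, uε − 1 ∈ 𝔟𝔟'⁻¹ }, a finite-index subgroup of 𝔬^× × E. Then the set of H-orbits of primitive classes of 𝔫⁻¹L/L is finite, of cardinality equal (as a rational number) to the sum, over all fractional ideals 𝔟' with 𝔟 ⊆ 𝔟' ⊆ 𝔫⁻¹𝔟, of #(𝔬/𝔟𝔟'⁻¹)^× · #(𝔬/𝔫𝔟'𝔟⁻¹)^×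 / [𝔬^× × E : 𝔬_𝒞^×(𝔟')]. -/

import Mathlib

open NumberField FractionalIdeal
open scoped nonZeroDivisors

variable {F : Type*} [Field F] [NumberField F]

/-- The different ideal `𝔡` of `F`, as a fractional ideal. -/
noncomputable def diffF (F : Type*) [Field F] [NumberField F] :
    FractionalIdeal (𝓞 F)⁰ F :=
  (differentIdeal ℤ (𝓞 F) : FractionalIdeal (𝓞 F)⁰ F)

lemma FI.add_mem {J : FractionalIdeal (𝓞 F)⁰ F} {x y : F} (hx : x ∈ J) (hy : y ∈ J) :
    x + y ∈ J := J.coeToSubmodule.add_mem hx hy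

lemma FI.neg_mem {J : FractionalIdeal (𝓞 F)⁰ F} {x : F} (hx : x ∈ J) : -x ∈ J :=
  J.coeToSubmodule.neg_mem hx

lemma FI.coe_mul_mem {J : FractionalIdeal (𝓞 F)⁰ F} (r : 𝓞 F) {x : F} (hx : x ∈ J) :
    (r : F) * x ∈ J := by
  have h : r • x ∈ (J : Submodule (𝓞 F) F) := Submodule.smul_mem _ r hx
  rwa [Algebra.smul_def] at h

lemma FI.unit_sub_one_mem {J : FractionalIdeal (𝓞 F)⁰ F} (w : (𝓞 F)ˣ)
    (h : ((w : 𝓞 F) : F) - 1 ∈ J) : (((w⁻¹ : (𝓞 F)ˣ) : 𝓞 F) : F) - 1 ∈ J := by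
  have h1 : (((w⁻¹ : (𝓞 F)ˣ) : 𝓞 F) : F) * ((w : 𝓞 F) : F) = 1 := by
    have := congrArg (fun x : 𝓞 F => (x : F)) w.inv_mul
    simpa using this
  have key : (((w⁻¹ : (𝓞 F)ˣ) : 𝓞 F) : F) - 1 =
      -((((w⁻¹ : (𝓞 F)ˣ) : 𝓞 F) : F) * (((w : 𝓞 F) : F) - 1)) := by
    linear_combination h1
  rw [key]
  exact FI.neg_mem (FI.coe_mul_mem _ h)

lemma FI.mul_unit_sub_one_mem {J : FractionalIdeal (𝓞 F)⁰ F} (w₁ w₂ : (𝓞 F)ˣ)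
    (h : ((w₁ : 𝓞 F) : F) * ((w₂ : 𝓞 F) : F) - 1 ∈ J) :
    (((w₁⁻¹ : (𝓞 F)ˣ) : 𝓞 F) : F) * (((w₂⁻¹ : (𝓞 F)ˣ) : 𝓞 F) : F) - 1 ∈ J := by
  have h' : (((w₁ * w₂ : (𝓞 F)ˣ) : 𝓞 F) : F) - 1 ∈ J := by
    have : (((w₁ * w₂ : (𝓞 F)ˣ) : 𝓞 F) : F) = ((w₁ : 𝓞 F) : F) * ((w₂ : 𝓞 F) : F) := by
      push_cast; ring
    rwa [this]
  have h2 := FI.unit_sub_one_mem (w₁ * w₂) h'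
  have : ((((w₁ * w₂)⁻¹ : (𝓞 F)ˣ) : 𝓞 F) : F) =
      (((w₁⁻¹ : (𝓞 F)ˣ) : 𝓞 F) : F) * (((w₂⁻¹ : (𝓞 F)ˣ) : 𝓞 F) : F) := by
    rw [mul_inv]; push_cast; ring
  rwa [this] at h2

/-- The subgroup `𝔬_𝒞^×(𝔟') = {(u, ε) ∈ 𝔬^× × E : u − 1 ∈ 𝔫𝔟'𝔟⁻¹, uε − 1 ∈ 𝔟𝔟'⁻¹}`
of `𝔬^× × E`. -/
noncomputable def OC (𝔫 : Ideal (𝓞 F)) (E : Subgroup (𝓞 F)ˣ)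
    (𝔟 𝔟' : FractionalIdeal (𝓞 F)⁰ F) : Subgroup ((𝓞 F)ˣ × E) where
  carrier := {p | (((p.1 : 𝓞 F) : F) - 1 ∈
      (𝔫 : FractionalIdeal (𝓞 F)⁰ F) * 𝔟' * 𝔟⁻¹) ∧
    (((p.1 : 𝓞 F) : F) * (((p.2 : (𝓞 F)ˣ) : 𝓞 F) : F) - 1 ∈ 𝔟 * 𝔟'⁻¹)}
  one_mem' := by
    constructor <;> simpa using FractionalIdeal.zero_mem _
  mul_mem' := by
    rintro p q ⟨hp1, hp2⟩ ⟨hq1, hq2⟩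
    refine ⟨?_, ?_⟩
    · show (((p.1 * q.1 : (𝓞 F)ˣ) : 𝓞 F) : F) - 1 ∈ _
      have key : (((p.1 * q.1 : (𝓞 F)ˣ) : 𝓞 F) : F) - 1 =
          ((p.1 : 𝓞 F) : F) * ((((q.1 : 𝓞 F) : F)) - 1) + (((p.1 : 𝓞 F) : F) - 1) := by
        push_cast; ring
      rw [key]
      exact FI.add_mem (FI.coe_mul_mem _ hq1) hp1
    · show (((p.1 * q.1 : (𝓞 F)ˣ) : 𝓞 F) : F) *
          ((((p.2 * q.2 : E) : (𝓞 F)ˣ) : 𝓞 F) : F) - 1 ∈ _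
      have key : (((p.1 * q.1 : (𝓞 F)ˣ) : 𝓞 F) : F) *
            ((((p.2 * q.2 : E) : (𝓞 F)ˣ) : 𝓞 F) : F) - 1 =
          ((p.1 * ((p.2 : (𝓞 F)ˣ) : 𝓞 F) : 𝓞 F) : F) *
              (((q.1 : 𝓞 F) : F) * (((q.2 : (𝓞 F)ˣ) : 𝓞 F) : F) - 1) +
            (((p.1 : 𝓞 F) : F) * (((p.2 : (𝓞 F)ˣ) : 𝓞 F) : F) - 1) := by
        push_cast; ring
      rw [key]
      exact FI.add_mem (FI.coe_mul_mem _ hq2) hp2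
  inv_mem' := by
    rintro p ⟨hp1, hp2⟩
    refine ⟨?_, ?_⟩
    · show (((p.1⁻¹ : (𝓞 F)ˣ) : 𝓞 F) : F) - 1 ∈ _
      exact FI.unit_sub_one_mem p.1 hp1
    · show (((p.1⁻¹ : (𝓞 F)ˣ) : 𝓞 F) : F) *
          ((((p.2⁻¹ : E) : (𝓞 F)ˣ) : 𝓞 F) : F) - 1 ∈ _
      have h2 := FI.mul_unit_sub_one_mem p.1 (p.2 : (𝓞 F)ˣ) hp2
      simpa using h2

/-- The ideal of `𝓞 F` consisting of the integral elements of a fractional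
ideal `J`; when `J` is integral this is just `J` viewed as an ideal, so that
`(𝓞 F) ⧸ idealOf J` is the residue ring `𝔬/J`. -/
noncomputable def idealOf (J : FractionalIdeal (𝓞 F)⁰ F) : Ideal (𝓞 F) :=
  Submodule.comap (Algebra.linearMap (𝓞 F) F) (J : Submodule (𝓞 F) F)

/-- A pair `(x, y) ∈ 𝔫⁻¹𝔟 × 𝔫⁻¹𝔞*` (with `𝔞 = 𝔟𝔠`) whose class in `𝔫⁻¹L/L`
(`L = 𝔟 ⊕ 𝔞*`) is a primitive vector of the `𝔬/𝔫`-module `𝔫⁻¹L/L`, i.e.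
`x𝔫𝔟⁻¹ + y𝔫𝔞𝔡 + 𝔫 = 𝔬`. -/
def PrimPair (𝔠 : FractionalIdeal (𝓞 F)⁰ F) (𝔫 : Ideal (𝓞 F))
    (𝔟 : FractionalIdeal (𝓞 F)⁰ F) : Type _ :=
  {p : F × F //
    p.1 ∈ (𝔫 : FractionalIdeal (𝓞 F)⁰ F)⁻¹ * 𝔟 ∧
    p.2 ∈ (𝔫 : FractionalIdeal (𝓞 F)⁰ F)⁻¹ * ((𝔟 * 𝔠)⁻¹ * (diffF F)⁻¹) ∧
    spanSingleton (𝓞 F)⁰ p.1 * ((𝔫 : FractionalIdeal (𝓞 F)⁰ F) * 𝔟⁻¹) +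
      spanSingleton (𝓞 F)⁰ p.2 * ((𝔫 : FractionalIdeal (𝓞 F)⁰ F) * (𝔟 * 𝔠) * diffF F) +
      (𝔫 : FractionalIdeal (𝓞 F)⁰ F) = 1}

/-- The relation on primitive pairs given by the action of the group `H` of
upper triangular matrices `(uε ξ; 0 u⁻¹)` (`u ∈ 𝔬^×`, `ε ∈ E`, `ξ ∈ (𝔠𝔟²)*`)
on row vectors, modulo the lattice `L = 𝔟 ⊕ 𝔞*`: its equivalence classes are
the `H`-orbits of primitive classes of `𝔫⁻¹L/L`. -/
def HRel (𝔠 : FractionalIdeal (𝓞 F)⁰ F) (𝔫 : Ideal (𝓞 F)) (E : Subgroup (𝓞 F)ˣ)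
    (𝔟 : FractionalIdeal (𝓞 F)⁰ F) :
    PrimPair 𝔠 𝔫 𝔟 → PrimPair 𝔠 𝔫 𝔟 → Prop := fun p q =>
  ∃ u : (𝓞 F)ˣ, ∃ ε ∈ E, ∃ ξ ∈ (𝔠 * 𝔟 ^ 2)⁻¹ * (diffF F)⁻¹,
    p.1.1 * (((u : 𝓞 F) : F) * ((ε : 𝓞 F) : F)) - q.1.1 ∈ 𝔟 ∧
    p.1.1 * ξ + p.1.2 * (((u⁻¹ : (𝓞 F)ˣ) : 𝓞 F) : F) - q.1.2 ∈
      (𝔟 * 𝔠)⁻¹ * (diffF F)⁻¹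

lemma mem_idealOf {J : FractionalIdeal (𝓞 F)⁰ F} {r : 𝓞 F} : r ∈ idealOf J ↔ (r : F) ∈ J :=
  Iff.rfl

lemma coe_idealOf {J : FractionalIdeal (𝓞 F)⁰ F} (h : J ≤ 1) :
    (idealOf J : FractionalIdeal (𝓞 F)⁰ F) = J := by
  obtain ⟨I, rfl⟩ := le_one_iff_exists_coeIdeal.mp h
  congr 1
  ext r
  rw [mem_idealOf, mem_coeIdeal]
  constructor
  · rintro ⟨s, hs, h⟩
    rwa [← RingOfIntegers.coe_injective h]
  · exact fun h => ⟨r, h, rfl⟩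

lemma finite_quotient_idealOf {J : FractionalIdeal (𝓞 F)⁰ F} (h : J ≤ 1) (h0 : J ≠ 0) :
    Finite (𝓞 F ⧸ idealOf J) := by
  refine Ideal.finiteQuotientOfFreeOfNeBot _ fun hb => h0 ?_
  rw [← coe_idealOf h, hb, coeIdeal_bot]

lemma mem_add_spanSingleton {A : FractionalIdeal (𝓞 F)⁰ F} {x z : F} :
    z ∈ A + spanSingleton (𝓞 F)⁰ x ↔ ∃ r : 𝓞 F, z - r * x ∈ A := by
  rw [FractionalIdeal.mem_add]
  constructor
  · rintro ⟨a, ha, b, hb, rfl⟩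
    obtain ⟨r, rfl⟩ := (mem_spanSingleton _).mp hb
    exact ⟨r, by simpa [Algebra.smul_def] using ha⟩
  · rintro ⟨r, hr⟩
    exact ⟨_, hr, r * x, (mem_spanSingleton _).mpr ⟨r, by simp [Algebra.smul_def]⟩, by ring⟩

lemma self_mem_add_spanSingleton (A : FractionalIdeal (𝓞 F)⁰ F) (x : F) :
    x ∈ A + spanSingleton (𝓞 F)⁰ x :=
  mem_add_spanSingleton.mpr ⟨1, by simp [FractionalIdeal.zero_mem]⟩

lemma add_spanSingleton_le {A : FractionalIdeal (𝓞 F)⁰ F} {x z : F} (r : 𝓞 F)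
    (h : z - r * x ∈ A) :
    A + spanSingleton (𝓞 F)⁰ z ≤ A + spanSingleton (𝓞 F)⁰ x := by
  rw [← sup_eq_add, ← sup_eq_add]
  refine sup_le le_sup_left ?_
  rw [spanSingleton_le_iff_mem, sup_eq_add]
  exact mem_add_spanSingleton.mpr ⟨r, h⟩

lemma add_spanSingleton_eq_of_unit {A : FractionalIdeal (𝓞 F)⁰ F} {x z : F} (w : (𝓞 F)ˣ)
    (h : x * ((w : 𝓞 F) : F) - z ∈ A) :
    A + spanSingleton (𝓞 F)⁰ x = A + spanSingleton (𝓞 F)⁰ z := by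
  have hw : (((w⁻¹ : (𝓞 F)ˣ) : 𝓞 F) : F) * ((w : 𝓞 F) : F) = 1 := by
    simp
  apply le_antisymm
  · apply add_spanSingleton_le ((w⁻¹ : (𝓞 F)ˣ) : 𝓞 F)
    have := FI.coe_mul_mem ((w⁻¹ : (𝓞 F)ˣ) : 𝓞 F) h
    convert this using 1
    linear_combination -x * hw
  · apply add_spanSingleton_le (w : 𝓞 F)
    convert FI.neg_mem h using 1
    ring

section Generators

variable {A B : FractionalIdeal (𝓞 F)⁰ F} {x₀ : F}

lemma mul_generator_mem_iff (hB : B ≠ 0) (h₀ : A + spanSingleton (𝓞 F)⁰ x₀ = B) (r : 𝓞 F) :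
    (r : F) * x₀ ∈ A ↔ r ∈ idealOf (A * B⁻¹) := by
  rw [mem_idealOf]
  constructor
  · intro h
    have key : spanSingleton (𝓞 F)⁰ (r : F) * B ≤ A := by
      rw [spanSingleton_mul_le_iff]
      intro z hz
      rw [← h₀, mem_add_spanSingleton] at hz
      obtain ⟨s, hs⟩ := hz
      have := FI.add_mem (FI.coe_mul_mem r hs) (FI.coe_mul_mem s h)
      convert this using 1
      ring
    rw [← spanSingleton_le_iff_mem]
    calc spanSingleton (𝓞 F)⁰ (r : F) = spanSingleton (𝓞 F)⁰ (r : F) * B * B⁻¹ := by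
          rw [mul_assoc, mul_inv_cancel₀ hB, mul_one]
      _ ≤ A * B⁻¹ := by gcongr
  · intro h
    have hx : x₀ ∈ B := h₀ ▸ self_mem_add_spanSingleton A x₀
    have := FractionalIdeal.mul_mem_mul h hx
    rwa [mul_assoc, inv_mul_cancel₀ hB, mul_one] at this

lemma exists_isUnit_of_generator (hB : B ≠ 0) (h₀ : A + spanSingleton (𝓞 F)⁰ x₀ = B) {x : F}
    (h : A + spanSingleton (𝓞 F)⁰ x = B) :
    ∃ r : 𝓞 F, IsUnit (Ideal.Quotient.mk (idealOf (A * B⁻¹)) r) ∧ x - r * x₀ ∈ A := by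
  have hx : x ∈ A + spanSingleton (𝓞 F)⁰ x₀ := by
    rw [h₀, ← h]
    exact self_mem_add_spanSingleton A x
  have hx₀ : x₀ ∈ A + spanSingleton (𝓞 F)⁰ x := by
    rw [h, ← h₀]
    exact self_mem_add_spanSingleton A x₀
  obtain ⟨r, hr⟩ := mem_add_spanSingleton.mp hx
  obtain ⟨s, hs⟩ := mem_add_spanSingleton.mp hx₀
  refine ⟨r, IsUnit.of_mul_eq_one (Ideal.Quotient.mk _ s) ?_, hr⟩
  rw [← map_mul, ← map_one (Ideal.Quotient.mk _), Ideal.Quotient.eq,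
    ← mul_generator_mem_iff hB h₀]
  convert FI.neg_mem (FI.add_mem hs (FI.coe_mul_mem s hr)) using 1
  push_cast
  ring

lemma generator_of_isUnit (hB : B ≠ 0) (h₀ : A + spanSingleton (𝓞 F)⁰ x₀ = B) {r : 𝓞 F}
    (hr : IsUnit (Ideal.Quotient.mk (idealOf (A * B⁻¹)) r)) :
    A + spanSingleton (𝓞 F)⁰ (r * x₀) = B := by
  obtain ⟨t, ht⟩ := hr.exists_right_inv
  obtain ⟨s, rfl⟩ := Ideal.Quotient.mk_surjective t
  rw [← map_mul, ← map_one (Ideal.Quotient.mk _), Ideal.Quotient.eq,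
    ← mul_generator_mem_iff hB h₀] at ht
  rw [← h₀]
  apply le_antisymm
  · exact add_spanSingleton_le r (by simpa using FractionalIdeal.zero_mem _)
  · apply add_spanSingleton_le s
    convert FI.neg_mem ht using 1
    push_cast
    ring

end Generators

/-- The homomorphism `(u, ε) ↦ (uε, u⁻¹)` from `𝔬^× × E` to `(𝔬/I)^× × (𝔬/J)^×`. -/
noncomputable def diagHom (E : Subgroup (𝓞 F)ˣ) (I J : Ideal (𝓞 F)) :
    (𝓞 F)ˣ × E →* (𝓞 F ⧸ I)ˣ × (𝓞 F ⧸ J)ˣ :=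
  ((Units.map (Ideal.Quotient.mk I : 𝓞 F →* 𝓞 F ⧸ I)).comp
      (MonoidHom.fst _ _ * E.subtype.comp (MonoidHom.snd _ _))).prod
    ((Units.map (Ideal.Quotient.mk J : 𝓞 F →* 𝓞 F ⧸ J)).comp (MonoidHom.fst _ _)⁻¹)

lemma diagHom_ker (𝔫 : Ideal (𝓞 F)) (E : Subgroup (𝓞 F)ˣ) (𝔟 𝔟' : FractionalIdeal (𝓞 F)⁰ F) :
    (diagHom E (idealOf (𝔟 * 𝔟'⁻¹))
      (idealOf ((𝔫 : FractionalIdeal (𝓞 F)⁰ F) * 𝔟' * 𝔟⁻¹))).ker = OC 𝔫 E 𝔟 𝔟' := by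
  ext ⟨u, ε⟩
  have h1 : ∀ (I : Ideal (𝓞 F)) (w : (𝓞 F)ˣ),
      Units.map (Ideal.Quotient.mk I : 𝓞 F →* 𝓞 F ⧸ I) w = 1 ↔ (w : 𝓞 F) - 1 ∈ I := by
    intro I w
    rw [Units.ext_iff, ← Ideal.Quotient.eq]
    simp
  have h2 : ((u, ε) : (𝓞 F)ˣ × E) ∈ OC 𝔫 E 𝔟 𝔟' ↔
      ((u : 𝓞 F) : F) - 1 ∈ (𝔫 : FractionalIdeal (𝓞 F)⁰ F) * 𝔟' * 𝔟⁻¹ ∧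
      ((u : 𝓞 F) : F) * (((ε : (𝓞 F)ˣ) : 𝓞 F) : F) - 1 ∈ 𝔟 * 𝔟'⁻¹ := Iff.rfl
  rw [h2, MonoidHom.mem_ker, diagHom, MonoidHom.prod_apply, Prod.mk_eq_one, and_comm]
  refine and_congr ?_ ?_
  · rw [MonoidHom.comp_apply, MonoidHom.inv_apply, map_inv, inv_eq_one, h1, mem_idealOf]
    simp
  · rw [MonoidHom.comp_apply, h1, mem_idealOf]
    simp

lemma card_quotient_range_diagHom (𝔫 : Ideal (𝓞 F)) (E : Subgroup (𝓞 F)ˣ)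
    (𝔟 𝔟' : FractionalIdeal (𝓞 F)⁰ F)
    [Finite (𝓞 F ⧸ idealOf (𝔟 * 𝔟'⁻¹))]
    [Finite (𝓞 F ⧸ idealOf ((𝔫 : FractionalIdeal (𝓞 F)⁰ F) * 𝔟' * 𝔟⁻¹))] :
    (Nat.card (((𝓞 F ⧸ idealOf (𝔟 * 𝔟'⁻¹))ˣ ×
        (𝓞 F ⧸ idealOf ((𝔫 : FractionalIdeal (𝓞 F)⁰ F) * 𝔟' * 𝔟⁻¹))ˣ) ⧸
        (diagHom E (idealOf (𝔟 * 𝔟'⁻¹))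
          (idealOf ((𝔫 : FractionalIdeal (𝓞 F)⁰ F) * 𝔟' * 𝔟⁻¹))).range) : ℚ) =
      ((Nat.card ((𝓞 F) ⧸ idealOf (𝔟 * 𝔟'⁻¹))ˣ : ℚ) *
        (Nat.card ((𝓞 F) ⧸ idealOf ((𝔫 : FractionalIdeal (𝓞 F)⁰ F) * 𝔟' * 𝔟⁻¹))ˣ : ℚ)) /
        ((OC 𝔫 E 𝔟 𝔟').index : ℚ) := by
  rw [← diagHom_ker, Subgroup.index_ker, eq_div_iff (by exact_mod_cast Nat.card_pos.ne'),
    ← Nat.cast_mul, ← Subgroup.card_eq_card_quotient_mul_card_subgroup, Nat.card_prod,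
    Nat.cast_mul]

section Orbits

variable {𝔠 : FractionalIdeal (𝓞 F)⁰ F} {𝔫 : Ideal (𝓞 F)} {E : Subgroup (𝓞 F)ˣ}
  {𝔟 : FractionalIdeal (𝓞 F)⁰ F}

lemma diffF_ne_zero : diffF F ≠ 0 :=
  coeIdeal_ne_zero.mpr differentIdeal_ne_bot

lemma primitive_iff (h𝔠 : 𝔠 ≠ 0) (h𝔫 : 𝔫 ≠ 0) (h𝔟 : 𝔟 ≠ 0) (x y : F) :
    spanSingleton (𝓞 F)⁰ x * ((𝔫 : FractionalIdeal (𝓞 F)⁰ F) * 𝔟⁻¹) +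
      spanSingleton (𝓞 F)⁰ y * ((𝔫 : FractionalIdeal (𝓞 F)⁰ F) * (𝔟 * 𝔠) * diffF F) +
      (𝔫 : FractionalIdeal (𝓞 F)⁰ F) = 1 ↔
    (𝔟 + spanSingleton (𝓞 F)⁰ x) * (𝔟⁻¹ * ((𝔟 * 𝔠)⁻¹ * (diffF F)⁻¹)) +
      spanSingleton (𝓞 F)⁰ y =
        (𝔫 : FractionalIdeal (𝓞 F)⁰ F)⁻¹ * ((𝔟 * 𝔠)⁻¹ * (diffF F)⁻¹) := by
  have hd := diffF_ne_zero (F := F)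
  have hn : (𝔫 : FractionalIdeal (𝓞 F)⁰ F) ≠ 0 := coeIdeal_ne_zero.mpr h𝔫
  have hM : (𝔫 : FractionalIdeal (𝓞 F)⁰ F) * (𝔟 * 𝔠) * diffF F ≠ 0 := by
    simp [hd, hn, h𝔟, h𝔠]
  refine Iff.trans (Eq.congr ?_ ?_) (mul_left_inj' hM)
  · field_simp
    ring
  · field_simp

lemma hRel_iff (h𝔟 : 𝔟 ≠ 0) (p q : PrimPair 𝔠 𝔫 𝔟) :
    HRel 𝔠 𝔫 E 𝔟 p q ↔ ∃ u : (𝓞 F)ˣ, ∃ ε ∈ E,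
      p.1.1 * (((u : 𝓞 F) : F) * ((ε : 𝓞 F) : F)) - q.1.1 ∈ 𝔟 ∧
      p.1.2 * (((u⁻¹ : (𝓞 F)ˣ) : 𝓞 F) : F) - q.1.2 ∈
        (𝔟 + spanSingleton (𝓞 F)⁰ p.1.1) * (𝔟⁻¹ * ((𝔟 * 𝔠)⁻¹ * (diffF F)⁻¹)) := by
  have e1 : (𝔠 * 𝔟 ^ 2)⁻¹ * (diffF F)⁻¹ = 𝔟⁻¹ * ((𝔟 * 𝔠)⁻¹ * (diffF F)⁻¹) := by
    rw [mul_inv, mul_inv, ← inv_pow]; ring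
  have e2 : (𝔟 + spanSingleton (𝓞 F)⁰ p.1.1) * (𝔟⁻¹ * ((𝔟 * 𝔠)⁻¹ * (diffF F)⁻¹)) =
      (𝔟 * 𝔠)⁻¹ * (diffF F)⁻¹ +
        spanSingleton (𝓞 F)⁰ p.1.1 * (𝔟⁻¹ * ((𝔟 * 𝔠)⁻¹ * (diffF F)⁻¹)) := by
    rw [add_mul, mul_inv_cancel_left₀ h𝔟]
  rw [e2]
  unfold HRel
  rw [e1]
  constructor
  · rintro ⟨u, ε, hε, ξ, hξ, h1, h2⟩
    refine ⟨u, ε, hε, h1, (FractionalIdeal.mem_add _ _ _).mpr ⟨_, h2, p.1.1 * (-ξ), ?_, by ring⟩⟩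
    exact mem_singleton_mul.mpr ⟨_, FI.neg_mem hξ, rfl⟩
  · rintro ⟨u, ε, hε, h1, h2⟩
    obtain ⟨a, ha, b, hb, hab⟩ := (FractionalIdeal.mem_add _ _ _).mp h2
    obtain ⟨ξ, hξ, rfl⟩ := mem_singleton_mul.mp hb
    refine ⟨u, ε, hε, -ξ, FI.neg_mem hξ, h1, ?_⟩
    convert ha using 1
    linear_combination -hab

lemma HRel.span_eq {p q : PrimPair 𝔠 𝔫 𝔟} (h : HRel 𝔠 𝔫 E 𝔟 p q) :
    𝔟 + spanSingleton (𝓞 F)⁰ p.1.1 = 𝔟 + spanSingleton (𝓞 F)⁰ q.1.1 := by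
  obtain ⟨u, ε, -, -, -, h, -⟩ := h
  exact add_spanSingleton_eq_of_unit (u * ε) (by simpa using h)

lemma hRel_equivalence (h𝔟 : 𝔟 ≠ 0) : Equivalence (HRel 𝔠 𝔫 E 𝔟) where
  refl p := (hRel_iff h𝔟 p p).mpr ⟨1, 1, E.one_mem, by simp [FractionalIdeal.zero_mem],
    by simp [FractionalIdeal.zero_mem]⟩
  symm {p q} h := by
    have hs := h.span_eq
    obtain ⟨u, ε, hε, h1, h2⟩ := (hRel_iff h𝔟 p q).mp h
    refine (hRel_iff h𝔟 q p).mpr ⟨u⁻¹, ε⁻¹, E.inv_mem hε, ?_, ?_⟩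
    · have hu : (((u⁻¹ : (𝓞 F)ˣ) : 𝓞 F) : F) * ((u : 𝓞 F) : F) = 1 := by
        simp
      have hv : (((ε⁻¹ : (𝓞 F)ˣ) : 𝓞 F) : F) * ((ε : 𝓞 F) : F) = 1 := by
        simp
      convert FI.neg_mem (FI.coe_mul_mem ((u⁻¹ : (𝓞 F)ˣ) : 𝓞 F)
        (FI.coe_mul_mem ((ε⁻¹ : (𝓞 F)ˣ) : 𝓞 F) h1)) using 1
      linear_combination p.1.1 * hu + p.1.1 * (((u⁻¹ : (𝓞 F)ˣ) : 𝓞 F) : F) *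
        ((u : 𝓞 F) : F) * hv
    · rw [← hs, inv_inv]
      have hu : (((u⁻¹ : (𝓞 F)ˣ) : 𝓞 F) : F) * ((u : 𝓞 F) : F) = 1 := by
        simp
      convert FI.neg_mem (FI.coe_mul_mem (u : 𝓞 F) h2) using 1
      linear_combination p.1.2 * hu
  trans {p q r} h h' := by
    have hs := h.span_eq
    obtain ⟨u, ε, hε, h1, h2⟩ := (hRel_iff h𝔟 p q).mp h
    obtain ⟨v, δ, hδ, h3, h4⟩ := (hRel_iff h𝔟 q r).mp h'
    refine (hRel_iff h𝔟 p r).mpr ⟨v * u, δ * ε, E.mul_mem hδ hε, ?_, ?_⟩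
    · convert FI.add_mem (FI.coe_mul_mem (v : 𝓞 F) (FI.coe_mul_mem (δ : 𝓞 F) h1)) h3 using 1
      push_cast
      ring
    · rw [← hs] at h4
      have e : ((((v * u)⁻¹ : (𝓞 F)ˣ) : 𝓞 F) : F) =
          (((v⁻¹ : (𝓞 F)ˣ) : 𝓞 F) : F) * (((u⁻¹ : (𝓞 F)ˣ) : 𝓞 F) : F) := by
        rw [mul_inv]
        push_cast
        ring
      convert FI.add_mem (FI.coe_mul_mem ((v⁻¹ : (𝓞 F)ˣ) : 𝓞 F) h2) h4 using 1
      linear_combination p.1.2 * e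

/-- The fractional ideals `𝔟'` with `𝔟 ⊆ 𝔟' ⊆ 𝔫⁻¹𝔟`. -/
abbrev intermediateIdeals (𝔫 : Ideal (𝓞 F)) (𝔟 : FractionalIdeal (𝓞 F)⁰ F) :
    Set (FractionalIdeal (𝓞 F)⁰ F) :=
  {J | 𝔟 ≤ J ∧ J ≤ (𝔫 : FractionalIdeal (𝓞 F)⁰ F)⁻¹ * 𝔟}

lemma ne_zero_of_mem_intermediateIdeals (h𝔟 : 𝔟 ≠ 0) {J : FractionalIdeal (𝓞 F)⁰ F}
    (hJ : J ∈ intermediateIdeals 𝔫 𝔟) : J ≠ 0 := by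
  rintro rfl
  exact h𝔟 (FractionalIdeal.le_zero_iff.mp hJ.1)

lemma mul_inv_le_one_of_mem (h𝔟 : 𝔟 ≠ 0) {J : FractionalIdeal (𝓞 F)⁰ F}
    (hJ : J ∈ intermediateIdeals 𝔫 𝔟) : 𝔟 * J⁻¹ ≤ 1 := by
  calc 𝔟 * J⁻¹ ≤ J * J⁻¹ := by gcongr; exact hJ.1
    _ = 1 := mul_inv_cancel₀ (ne_zero_of_mem_intermediateIdeals h𝔟 hJ)

lemma coe_mul_mul_inv_le_one_of_mem (h𝔫 : 𝔫 ≠ 0) (h𝔟 : 𝔟 ≠ 0) {J : FractionalIdeal (𝓞 F)⁰ F}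
    (hJ : J ∈ intermediateIdeals 𝔫 𝔟) : (𝔫 : FractionalIdeal (𝓞 F)⁰ F) * J * 𝔟⁻¹ ≤ 1 := by
  have hn : (𝔫 : FractionalIdeal (𝓞 F)⁰ F) ≠ 0 := coeIdeal_ne_zero.mpr h𝔫
  calc (𝔫 : FractionalIdeal (𝓞 F)⁰ F) * J * 𝔟⁻¹
      ≤ 𝔫 * ((𝔫 : FractionalIdeal (𝓞 F)⁰ F)⁻¹ * 𝔟) * 𝔟⁻¹ := by gcongr; exact hJ.2
    _ = 1 := by rw [mul_inv_cancel_left₀ hn, mul_inv_cancel₀ h𝔟]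

lemma finite_intermediateIdeals (h𝔫 : 𝔫 ≠ 0) (h𝔟 : 𝔟 ≠ 0) :
    Finite (intermediateIdeals 𝔫 𝔟) := by
  have hn : (𝔫 : FractionalIdeal (𝓞 F)⁰ F) ≠ 0 := coeIdeal_ne_zero.mpr h𝔫
  have := UniqueFactorizationMonoid.fintypeSubtypeDvd 𝔫 h𝔫
  refine Finite.of_injective (β := {I : Ideal (𝓞 F) // I ∣ 𝔫})
    (fun J => ⟨idealOf (𝔟 * J.1⁻¹), Ideal.dvd_iff_le.mpr ?_⟩) ?_
  · rw [← coeIdeal_le_coeIdeal F, coe_idealOf (mul_inv_le_one_of_mem h𝔟 J.2)]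
    have h0 := ne_zero_of_mem_intermediateIdeals h𝔟 J.2
    calc (𝔫 : FractionalIdeal (𝓞 F)⁰ F) = 𝔫 * J.1 * J.1⁻¹ := by
          rw [mul_assoc, mul_inv_cancel₀ h0, mul_one]
      _ ≤ 𝔫 * ((𝔫 : FractionalIdeal (𝓞 F)⁰ F)⁻¹ * 𝔟) * J.1⁻¹ := by gcongr; exact J.2.2
      _ = 𝔟 * J.1⁻¹ := by rw [mul_inv_cancel_left₀ hn]
  · intro J K h
    have h' := congrArg (fun I : Ideal (𝓞 F) => (I : FractionalIdeal (𝓞 F)⁰ F))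
      (Subtype.ext_iff.mp h)
    simp only [coe_idealOf (mul_inv_le_one_of_mem h𝔟 J.2),
      coe_idealOf (mul_inv_le_one_of_mem h𝔟 K.2)] at h'
    exact Subtype.ext (inv_injective (mul_left_cancel₀ h𝔟 h'))

/-- The orbits of pairs whose first coordinate generates `J` modulo `𝔟` are represented by a family
indexed by `(𝔬/𝔟J⁻¹)^× × (𝔬/𝔫J𝔟⁻¹)^×`, two members being related exactly when their indices agree
modulo the image of `𝔬^× × E`. -/
lemma exists_representatives (h𝔠 : 𝔠 ≠ 0) (h𝔫 : 𝔫 ≠ 0) (h𝔟 : 𝔟 ≠ 0)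
    {J : FractionalIdeal (𝓞 F)⁰ F} (hJ : J ∈ intermediateIdeals 𝔫 𝔟) :
    ∃ g : (𝓞 F ⧸ idealOf (𝔟 * J⁻¹))ˣ ×
        (𝓞 F ⧸ idealOf ((𝔫 : FractionalIdeal (𝓞 F)⁰ F) * J * 𝔟⁻¹))ˣ → PrimPair 𝔠 𝔫 𝔟,
      (∀ a, 𝔟 + spanSingleton (𝓞 F)⁰ (g a).1.1 = J) ∧
      (∀ a b, HRel 𝔠 𝔫 E 𝔟 (g a) (g b) ↔ a⁻¹ * b ∈ (diagHom E _ _).range) ∧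
      (∀ p : PrimPair 𝔠 𝔫 𝔟, 𝔟 + spanSingleton (𝓞 F)⁰ p.1.1 = J →
        ∃ a, HRel 𝔠 𝔫 E 𝔟 (g a) p) := by
  set W := (𝔟 * 𝔠)⁻¹ * (diffF F)⁻¹ with hW
  have hn : (𝔫 : FractionalIdeal (𝓞 F)⁰ F) ≠ 0 := coeIdeal_ne_zero.mpr h𝔫
  have hW0 : W ≠ 0 := by simp [hW, h𝔟, h𝔠, diffF_ne_zero]
  have hJ0 := ne_zero_of_mem_intermediateIdeals h𝔟 hJ
  have hM0 : (𝔫 : FractionalIdeal (𝓞 F)⁰ F)⁻¹ * W ≠ 0 := by simp [hn, hW0]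
  have hD0 : J * (𝔟⁻¹ * W) ≠ 0 := by simp [hJ0, h𝔟, hW0]
  have hDM : J * (𝔟⁻¹ * W) ≤ (𝔫 : FractionalIdeal (𝓞 F)⁰ F)⁻¹ * W := by
    calc J * (𝔟⁻¹ * W) ≤ ((𝔫 : FractionalIdeal (𝓞 F)⁰ F)⁻¹ * 𝔟) * (𝔟⁻¹ * W) := by
          gcongr; exact hJ.2
      _ = _ := by rw [mul_assoc, mul_inv_cancel_left₀ h𝔟]
  have hJ' : J * (𝔟⁻¹ * W) * ((𝔫 : FractionalIdeal (𝓞 F)⁰ F)⁻¹ * W)⁻¹ =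
      (𝔫 : FractionalIdeal (𝓞 F)⁰ F) * J * 𝔟⁻¹ := by
    field_simp
  obtain ⟨x₀, hx₀⟩ := IsDedekindDomain.exists_add_spanSingleton_mul_eq hJ.1 h𝔟 one_ne_zero
  obtain ⟨y₀, hy₀⟩ := IsDedekindDomain.exists_add_spanSingleton_mul_eq hDM hD0 one_ne_zero
  rw [mul_one] at hx₀ hy₀
  have memx := mul_generator_mem_iff hJ0 hx₀
  have memy := mul_generator_mem_iff hM0 hy₀
  have genx := fun r => generator_of_isUnit (r := r) hJ0 hx₀
  have geny := fun r => generator_of_isUnit (r := r) hM0 hy₀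
  have exx := fun x => exists_isUnit_of_generator (x := x) hJ0 hx₀
  have exy := fun y => exists_isUnit_of_generator (x := y) hM0 hy₀
  rw [hJ'] at memy geny exy
  have self_mem : ∀ {A B : FractionalIdeal (𝓞 F)⁰ F} {x : F},
      A + spanSingleton (𝓞 F)⁰ x = B → x ∈ B :=
    fun h => h ▸ self_mem_add_spanSingleton _ _
  have surj : ∀ (I : Ideal (𝓞 F)) (a : (𝓞 F ⧸ I)ˣ), ∃ r : 𝓞 F, Ideal.Quotient.mk I r = a :=
    fun I a => Ideal.Quotient.mk_surjective _
  choose out mk_out using surj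
  have hgx : ∀ a : (𝓞 F ⧸ idealOf (𝔟 * J⁻¹))ˣ,
      𝔟 + spanSingleton (𝓞 F)⁰ ((out _ a : F) * x₀) = J :=
    fun a => genx _ (by rw [mk_out]; exact a.isUnit)
  have hgy : ∀ a : (𝓞 F ⧸ idealOf ((𝔫 : FractionalIdeal (𝓞 F)⁰ F) * J * 𝔟⁻¹))ˣ,
      J * (𝔟⁻¹ * W) + spanSingleton (𝓞 F)⁰ ((out _ a : F) * y₀) =
        (𝔫 : FractionalIdeal (𝓞 F)⁰ F)⁻¹ * W :=
    fun a => geny _ (by rw [mk_out]; exact a.isUnit)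
  obtain ⟨g, hg1, hg2⟩ : ∃ g : (𝓞 F ⧸ idealOf (𝔟 * J⁻¹))ˣ ×
      (𝓞 F ⧸ idealOf ((𝔫 : FractionalIdeal (𝓞 F)⁰ F) * J * 𝔟⁻¹))ˣ → PrimPair 𝔠 𝔫 𝔟,
      (∀ a, (g a).1.1 = out _ a.1 * x₀) ∧ ∀ a, (g a).1.2 = out _ a.2 * y₀ := by
    refine ⟨fun a => ⟨((out _ a.1 : F) * x₀, (out _ a.2 : F) * y₀),
      hJ.2 (self_mem (hgx a.1)), self_mem (hgy a.2), ?_⟩, fun _ => rfl, fun _ => rfl⟩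
    rw [primitive_iff h𝔠 h𝔫 h𝔟, hgx a.1]
    exact hgy a.2
  refine ⟨g, fun a => by rw [hg1, hgx], ?_, ?_⟩
  · intro a b
    rw [hRel_iff h𝔟, hg1, hg1, hg2, hg2, hgx]
    have key : ∀ (I : Ideal (𝓞 F)) (c d : (𝓞 F ⧸ I)ˣ) (w : (𝓞 F)ˣ),
        (out I c * w - out I d ∈ I ↔
          Units.map (Ideal.Quotient.mk I : 𝓞 F →* 𝓞 F ⧸ I) w = c⁻¹ * d) := by
      intro I c d w
      rw [← Ideal.Quotient.eq, map_mul, mk_out, mk_out, eq_inv_mul_iff_mul_eq, Units.ext_iff]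
      simp
    constructor
    · rintro ⟨u, ε, hε, h1, h2⟩
      refine ⟨(u, ⟨ε, hε⟩), Prod.ext ?_ ?_⟩
      · refine (key _ a.1 b.1 (u * ε)).mp ((memx _).mp ?_)
        convert h1 using 1
        push_cast
        ring
      · refine (key _ a.2 b.2 u⁻¹).mp ((memy _).mp ?_)
        convert h2 using 1
        push_cast
        ring
    · rintro ⟨⟨u, ε, hε⟩, h⟩
      refine ⟨u, ε, hε, ?_, ?_⟩
      · convert (memx _).mpr ((key _ a.1 b.1 (u * ε)).mpr (congrArg Prod.fst h)) using 1
        push_cast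
        ring
      · convert (memy _).mpr ((key _ a.2 b.2 u⁻¹).mpr (congrArg Prod.snd h)) using 1
        push_cast
        ring
  · intro p hp
    have hpy := (primitive_iff h𝔠 h𝔫 h𝔟 p.1.1 p.1.2).mp p.2.2.2
    rw [hp] at hpy
    obtain ⟨r, hr, hrx⟩ := exx _ hp
    obtain ⟨s, hs, hsy⟩ := exy _ hpy
    refine ⟨(hr.unit, hs.unit), (hRel_iff h𝔟 _ _).mpr ⟨1, 1, E.one_mem, ?_, ?_⟩⟩
    · rw [hg1]
      have h1 : out _ hr.unit - r ∈ idealOf (𝔟 * J⁻¹) := by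
        rw [← Ideal.Quotient.eq, mk_out, IsUnit.unit_spec]
      convert FI.add_mem ((memx _).mpr h1) (FI.neg_mem hrx) using 1
      push_cast
      ring
    · rw [hg1, hg2, hgx, inv_one]
      have h1 : out _ hs.unit - s ∈ idealOf ((𝔫 : FractionalIdeal (𝓞 F)⁰ F) * J * 𝔟⁻¹) := by
        rw [← Ideal.Quotient.eq, mk_out, IsUnit.unit_spec]
      convert FI.add_mem ((memy _).mpr h1) (FI.neg_mem hsy) using 1
      push_cast
      ring

lemma span_mem_intermediateIdeals (h𝔫 : 𝔫 ≠ 0) (p : PrimPair 𝔠 𝔫 𝔟) :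
    𝔟 + spanSingleton (𝓞 F)⁰ p.1.1 ∈ intermediateIdeals 𝔫 𝔟 := by
  have hn : (𝔫 : FractionalIdeal (𝓞 F)⁰ F) ≠ 0 := coeIdeal_ne_zero.mpr h𝔫
  rw [← sup_eq_add]
  refine ⟨le_sup_left, sup_le ?_ (spanSingleton_le_iff_mem.mpr p.2.1)⟩
  calc 𝔟 = (𝔫 : FractionalIdeal (𝓞 F)⁰ F)⁻¹ * (𝔫 * 𝔟) := (inv_mul_cancel_left₀ hn _).symm
    _ ≤ (𝔫 : FractionalIdeal (𝓞 F)⁰ F)⁻¹ * (1 * 𝔟) := by gcongr; exact coeIdeal_le_one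
    _ = _ := by rw [one_mul]

lemma nonempty_equiv_orbits (h𝔠 : 𝔠 ≠ 0) (h𝔫 : 𝔫 ≠ 0) (h𝔟 : 𝔟 ≠ 0) :
    Nonempty ((Σ J : intermediateIdeals 𝔫 𝔟, ((𝓞 F ⧸ idealOf (𝔟 * J.1⁻¹))ˣ ×
        (𝓞 F ⧸ idealOf ((𝔫 : FractionalIdeal (𝓞 F)⁰ F) * J.1 * 𝔟⁻¹))ˣ) ⧸
        (diagHom E (idealOf (𝔟 * J.1⁻¹))
          (idealOf ((𝔫 : FractionalIdeal (𝓞 F)⁰ F) * J.1 * 𝔟⁻¹))).range) ≃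
      Quot (HRel 𝔠 𝔫 E 𝔟)) := by
  choose g hg hrel hsurj using fun J : intermediateIdeals 𝔫 𝔟 =>
    exists_representatives (E := E) h𝔠 h𝔫 h𝔟 J.2
  have exact_rel : ∀ {p q : PrimPair 𝔠 𝔫 𝔟},
      Quot.mk (HRel 𝔠 𝔫 E 𝔟) p = Quot.mk _ q → HRel 𝔠 𝔫 E 𝔟 p q := fun h =>
    (hRel_equivalence h𝔟).eqvGen_iff.mp (Quot.eqvGen_exact h)
  refine ⟨Equiv.ofBijective (fun c => Quot.mk _ (g c.1 c.2.out)) ⟨?_, ?_⟩⟩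
  · rintro ⟨J, c⟩ ⟨K, d⟩ h
    have hr := exact_rel h
    obtain rfl : J = K := Subtype.ext (by rw [← hg J c.out, ← hg K d.out]; exact hr.span_eq)
    rw [hrel, ← QuotientGroup.eq, QuotientGroup.out_eq', QuotientGroup.out_eq'] at hr
    exact congrArg (Sigma.mk J) hr
  · rintro ⟨p⟩
    obtain ⟨J, hJ⟩ : ∃ J : intermediateIdeals 𝔫 𝔟, 𝔟 + spanSingleton (𝓞 F)⁰ p.1.1 = J.1 :=
      ⟨⟨_, span_mem_intermediateIdeals h𝔫 p⟩, rfl⟩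
    obtain ⟨a, ha⟩ := hsurj J p hJ
    refine ⟨⟨J, QuotientGroup.mk a⟩, Quot.sound ((hRel_equivalence h𝔟).trans ?_ ha)⟩
    rw [hrel, ← QuotientGroup.eq, QuotientGroup.out_eq']

end Orbits

/-- Proposition `deuxideaux (v)`: the set of `H`-orbits of primitive classes
of `𝔫⁻¹L/L` (the fiber over `𝔟` of the set of `(R,𝔫)`-cusps) is finite, of
cardinality `∑_{𝔟 ⊆ 𝔟' ⊆ 𝔫⁻¹𝔟} #(𝔬/𝔟𝔟'⁻¹)^× ⬝ #(𝔬/𝔫𝔟'𝔟⁻¹)^× / [𝔬^× × E : 𝔬_𝒞^×(𝔟')]`. -/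
theorem stmt13 (F : Type*) [Field F] [NumberField F]
    (htotreal : ∀ φ : F →+* ℂ, ComplexEmbedding.IsReal φ)
    (𝔠 : FractionalIdeal (𝓞 F)⁰ F) (h𝔠 : 𝔠 ≠ 0)
    (𝔫 : Ideal (𝓞 F)) (h𝔫 : 𝔫 ≠ 0)
    (E : Subgroup (𝓞 F)ˣ)
    (hE : ∀ u ∈ E, ∀ φ : F →+* ℝ, 0 < φ ((u : 𝓞 F) : F))
    (𝔟 : FractionalIdeal (𝓞 F)⁰ F) (h𝔟 : 𝔟 ≠ 0) :
    Finite (Quot (HRel 𝔠 𝔫 E 𝔟)) ∧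
    (Nat.card (Quot (HRel 𝔠 𝔫 E 𝔟)) : ℚ) =
      ∑ᶠ 𝔟' ∈ {J : FractionalIdeal (𝓞 F)⁰ F |
          𝔟 ≤ J ∧ J ≤ (𝔫 : FractionalIdeal (𝓞 F)⁰ F)⁻¹ * 𝔟},
        ((Nat.card ((𝓞 F) ⧸ idealOf (𝔟 * 𝔟'⁻¹))ˣ : ℚ) *
            (Nat.card ((𝓞 F) ⧸ idealOf ((𝔫 : FractionalIdeal (𝓞 F)⁰ F) * 𝔟' * 𝔟⁻¹))ˣ : ℚ)) /
          ((OC 𝔫 E 𝔟 𝔟').index : ℚ) := by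
  have := finite_intermediateIdeals h𝔫 h𝔟
  have fin1 (J : intermediateIdeals 𝔫 𝔟) : Finite (𝓞 F ⧸ idealOf (𝔟 * J.1⁻¹)) :=
    finite_quotient_idealOf (mul_inv_le_one_of_mem h𝔟 J.2)
      (by simp [h𝔟, ne_zero_of_mem_intermediateIdeals h𝔟 J.2])
  have fin2 (J : intermediateIdeals 𝔫 𝔟) :
      Finite (𝓞 F ⧸ idealOf ((𝔫 : FractionalIdeal (𝓞 F)⁰ F) * J.1 * 𝔟⁻¹)) :=
    finite_quotient_idealOf (coe_mul_mul_inv_le_one_of_mem h𝔫 h𝔟 J.2)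
      (by simpa [h𝔟, ne_zero_of_mem_intermediateIdeals h𝔟 J.2] using h𝔫)
  obtain ⟨e⟩ := nonempty_equiv_orbits (E := E) h𝔠 h𝔫 h𝔟
  have := Fintype.ofFinite (intermediateIdeals 𝔫 𝔟)
  refine ⟨Finite.of_equiv _ e, ?_⟩
  rw [← Nat.card_congr e, Nat.card_sigma, Nat.cast_sum, ← finsum_set_coe_eq_finsum_mem,
    finsum_eq_sum_of_fintype]
  exact Finset.sum_congr rfl fun J _ => card_quotient_range_diagHom 𝔫 E 𝔟 J.1
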